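/- There exist a constant c > 0 and N ∈ ℕ such that for every n ≥ N there are two symmetric generating sets S_n and S_n' of the symmetric group Sym(n), each consisting only of transpositions, with the following properties: (i) the identity map on Sym(n) is a (3,0)-quasi-isometry between the Cayley graphs Cay(Sym(n),S_n) and Cay(Sym(n),S_n'), i.e. for all σ,τ ∈ Sym(n) one has d'(σ,τ) ≤ 3·d(σ,τ) and d(σ,τ) ≤ 3·d'(σ,τ), where d and d' denote the graph distances in Cay(Sym(n),S_n) and Cay(Sym(n),S_n') respectively; and (ii) mix(Cay(Sym(n),S_n')) ≥ c · mix(Cay(Sym(n),S_n)) · log log log (n!). -/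

import Mathlib

open Finset

/-- A symmetric generating set of a group: does not contain the identity, is closed under
inverses, and generates the group. -/
def IsSymmGen {G : Type*} [Group G] (S : Finset G) : Prop :=
  (1 : G) ∉ S ∧ (∀ s ∈ S, s⁻¹ ∈ S) ∧ Subgroup.closure (S : Set G) = ⊤

/-- Transition matrix of the lazy simple random walk on the Cayley graph `Cay(G,S)`:
`P(g,g) = 1/2` and `P(g,gs) = 1/(2|S|)` for `s ∈ S`. -/
noncomputable def lazyCayleyP {G : Type*} [Group G] [Fintype G] [DecidableEq G]
    (S : Finset G) : Matrix G G ℝ :=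
  fun g h => if h = g then 1 / 2 else if g⁻¹ * h ∈ S then 1 / (2 * (S.card : ℝ)) else 0

/-- Total variation mixing time of a discrete-time chain with transition matrix `P` whose
stationary distribution is uniform. -/
noncomputable def tvMixUnif {G : Type*} [Fintype G] [DecidableEq G] (P : Matrix G G ℝ) : ℕ :=
  sInf {t : ℕ | ∀ x : G, (∑ y : G, |(P ^ t) x y - 1 / (Fintype.card G : ℝ)|) / 2 ≤ 1 / 4}

/-- The word metric on a group with respect to a set of generators `S`: the least `k` such
that `x⁻¹y` is a product of `k` elements of `S`. -/
noncomputable def wordDist {G : Type*} [Group G] (S : Finset G) (x y : G) : ℕ :=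
  sInf {k : ℕ | ∃ l : List G, l.length = k ∧ (∀ s ∈ l, s ∈ S) ∧ x⁻¹ * y = l.prod}

theorem lazy_step {G : Type*} [Group G] [Fintype G] [DecidableEq G] (S : Finset G)
    (h1 : (1 : G) ∉ S) (f : G → ℝ) (g : G) :
    ∑ h, lazyCayleyP S g h * f h
      = 1 / 2 * f g + 1 / (2 * (S.card : ℝ)) * ∑ s ∈ S, f (g * s) := by
  have e1 : ∀ h, lazyCayleyP S g h * f h =
      (if h = g then 1 / 2 * f g else 0)
        + (if g⁻¹ * h ∈ S then 1 / (2 * (S.card : ℝ)) * f h else 0) := by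
    intro h
    unfold lazyCayleyP
    by_cases hg : h = g
    · subst hg; simp [h1]
    · by_cases hs : g⁻¹ * h ∈ S <;> simp [hg, hs]
  rw [Finset.sum_congr rfl (fun h _ => e1 h), Finset.sum_add_distrib]
  congr 1
  · simp
  · rw [← Equiv.sum_comp (Equiv.mulLeft g), Finset.mul_sum]
    simp [Finset.sum_ite_mem]

theorem pow_step {G : Type*} [Group G] [Fintype G] [DecidableEq G] (S : Finset G)
    (h1 : (1 : G) ∉ S) (t : ℕ) (x z : G) :
    (lazyCayleyP S ^ (t + 1)) x z
      = 1 / 2 * (lazyCayleyP S ^ t) x z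
        + 1 / (2 * (S.card : ℝ)) * ∑ s ∈ S, (lazyCayleyP S ^ t) (x * s) z := by
  rw [pow_succ', Matrix.mul_apply]
  exact lazy_step S h1 (fun h => (lazyCayleyP S ^ t) h z) x

theorem pow_nonneg_entry {G : Type*} [Group G] [Fintype G] [DecidableEq G] (S : Finset G)
    (h1 : (1 : G) ∉ S) (t : ℕ) : ∀ (x z : G), 0 ≤ (lazyCayleyP S ^ t) x z := by
  induction t with
  | zero => intro x z; simp only [pow_zero, Matrix.one_apply]; split_ifs <;> norm_num
  | succ t ih =>
    intro x z
    rw [pow_step S h1]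
    have : 0 ≤ ∑ s ∈ S, (lazyCayleyP S ^ t) (x * s) z := Finset.sum_nonneg (fun s _ => ih _ _)
    have := ih x z
    positivity

theorem pow_row_sum {G : Type*} [Group G] [Fintype G] [DecidableEq G] (S : Finset G)
    (h1 : (1 : G) ∉ S) (hS : S.Nonempty) (t : ℕ) :
    ∀ (x : G), ∑ z, (lazyCayleyP S ^ t) x z = 1 := by
  have hc : (S.card : ℝ) ≠ 0 := by exact_mod_cast hS.card_ne_zero
  induction t with
  | zero => intro x; simp [Matrix.one_apply]
  | succ t ih =>
    intro x
    simp_rw [pow_step S h1]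
    rw [Finset.sum_add_distrib, ← Finset.mul_sum, ← Finset.mul_sum, ih, Finset.sum_comm]
    simp_rw [ih]
    simp
    field_simp
    norm_num

theorem lazy_symm {G : Type*} [Group G] [Fintype G] [DecidableEq G] (S : Finset G)
    (hinv : ∀ s ∈ S, s⁻¹ ∈ S) : (lazyCayleyP S).transpose = lazyCayleyP S := by
  ext g h
  simp only [Matrix.transpose_apply, lazyCayleyP]
  have : h⁻¹ * g ∈ S ↔ g⁻¹ * h ∈ S := by
    constructor
    · intro hh; simpa using hinv _ hh
    · intro hh; simpa using hinv _ hh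
  simp only [this, eq_comm]

theorem pow_col_sum {G : Type*} [Group G] [Fintype G] [DecidableEq G] (S : Finset G)
    (h1 : (1 : G) ∉ S) (hinv : ∀ s ∈ S, s⁻¹ ∈ S) (hS : S.Nonempty) (t : ℕ) (z : G) :
    ∑ x, (lazyCayleyP S ^ t) x z = 1 := by
  rw [← pow_row_sum S h1 hS t z]
  apply Finset.sum_congr rfl
  intro x _
  conv_rhs => rw [← lazy_symm S hinv, ← Matrix.transpose_pow]
  rfl

theorem exists_list_of_gen {G : Type*} [Group G] (S : Finset G) (hS : IsSymmGen S) (g : G) :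
    ∃ l : List G, (∀ s ∈ l, s ∈ S) ∧ g = l.prod := by
  have hg : g ∈ Subgroup.closure (S : Set G) := by rw [hS.2.2]; trivial
  rw [← Subgroup.mem_toSubmonoid, Subgroup.closure_toSubmonoid] at hg
  obtain ⟨l, hl, rfl⟩ := Submonoid.exists_list_of_mem_closure hg
  refine ⟨l, fun s hs => ?_, rfl⟩
  rcases hl s hs with h | h
  · exact_mod_cast h
  · have h' : s⁻¹ ∈ S := by exact_mod_cast Set.mem_inv.mp h
    simpa using hS.2.1 _ h'

theorem pow_pos_of_list {G : Type*} [Group G] [Fintype G] [DecidableEq G] (S : Finset G)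
    (h1 : (1 : G) ∉ S) (l : List G) (hl : ∀ s ∈ l, s ∈ S) (t : ℕ) (ht : l.length ≤ t) (x : G) :
    0 < (lazyCayleyP S ^ t) x (x * l.prod) := by
  induction t generalizing l x with
  | zero =>
    have : l = [] := List.eq_nil_of_length_eq_zero (by omega)
    subst this; simp
  | succ t ih =>
    rw [pow_step S h1]
    cases l with
    | nil =>
      have a := ih [] (by simp) (by simp) x
      have : 0 ≤ ∑ s ∈ S, (lazyCayleyP S ^ t) (x * s) (x * ([] : List G).prod) :=
        Finset.sum_nonneg (fun s _ => pow_nonneg_entry S h1 t _ _)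
      positivity
    | cons s l =>
      have hs : s ∈ S := hl s (by simp)
      have a := ih l (fun s hs => hl s (by simp [hs])) (by simpa using ht) (x * s)
      have b : 0 < ∑ s' ∈ S, (lazyCayleyP S ^ t) (x * s') (x * (s :: l).prod) := by
        refine Finset.sum_pos' (fun s _ => pow_nonneg_entry S h1 t _ _) ⟨s, hs, ?_⟩
        simpa [mul_assoc] using a
      have c := pow_nonneg_entry S h1 t x (x * (s :: l).prod)
      have d : 0 < (S.card : ℝ) := by exact_mod_cast Finset.card_pos.mpr ⟨s, hs⟩
      positivity

/-- The chain converges, so the set defining the mixing time is nonempty. -/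
theorem mix_set_nonempty {G : Type*} [Group G] [Fintype G] [DecidableEq G] (S : Finset G)
    (hS : IsSymmGen S) (hne : S.Nonempty) :
    ∃ t : ℕ, ∀ x : G,
      (∑ y : G, |(lazyCayleyP S ^ t) x y - 1 / (Fintype.card G : ℝ)|) / 2 ≤ 1 / 4 := by
  have h1 := hS.1
  choose l hl hlp using exists_list_of_gen S hS
  obtain ⟨T, hT⟩ : ∃ T : ℕ, ∀ g, (l g).length ≤ T :=
    ⟨Finset.univ.sup (fun g => (l g).length),
      fun g => Finset.le_sup (f := fun g => (l g).length) (Finset.mem_univ g)⟩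
  set A := lazyCayleyP S ^ T with hA
  have hpos : ∀ x y, 0 < A x y := by
    intro x y
    have := pow_pos_of_list S h1 (l (x⁻¹ * y)) (hl _) T (hT _) x
    rwa [← hlp, mul_inv_cancel_left] at this
  obtain ⟨p, -, hp⟩ := Finset.exists_min_image (Finset.univ : Finset (G × G))
    (fun p => A p.1 p.2) ⟨(1, 1), Finset.mem_univ _⟩
  set δ := A p.1 p.2 with hδ
  have hδpos : 0 < δ := hpos _ _
  have hmin : ∀ x y, δ ≤ A x y := fun x y => hp (x, y) (Finset.mem_univ _)
  set n : ℝ := (Fintype.card G : ℝ) with hn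
  have hnpos : 0 < n := by rw [hn]; exact_mod_cast Fintype.card_pos
  have hδn : 0 ≤ 1 - n * δ := by
    have := pow_row_sum S h1 hne T 1
    have h2 : ∑ _z : G, δ ≤ ∑ z, A 1 z := Finset.sum_le_sum (fun z _ => hmin _ _)
    rw [this] at h2
    simp at h2
    linarith
  have key : ∀ k x, ∑ y : G, |(lazyCayleyP S ^ (T * k)) x y - 1 / n| ≤ (1 - n * δ) ^ k * 2 := by
    intro k
    induction k with
    | zero =>
      intro x
      have : ∀ y, |(lazyCayleyP S ^ (T * 0)) x y - 1 / n|
          ≤ (lazyCayleyP S ^ (T * 0)) x y + 1 / n := by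
        intro y
        refine (abs_sub _ _).trans ?_
        rw [abs_of_nonneg (pow_nonneg_entry S h1 _ x y), abs_of_pos (by positivity)]
      refine (Finset.sum_le_sum (fun y _ => this y)).trans ?_
      rw [Finset.sum_add_distrib, pow_row_sum S h1 hne]
      simp only [Finset.sum_const, Finset.card_univ, nsmul_eq_mul, ← hn]
      field_simp
      norm_num
    | succ k ih =>
      intro x
      set B := lazyCayleyP S ^ (T * k) with hB
      have e : ∀ y, (lazyCayleyP S ^ (T * (k + 1))) x y - 1 / n
          = ∑ w, (B x w - 1 / n) * (A w y - δ) := by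
        intro y
        have hc := pow_col_sum S h1 hS.2.1 hne T y
        have hr := pow_row_sum S h1 hne (T * k) x
        rw [← hA] at hc
        rw [← hB] at hr
        have : ∑ w, (B x w - 1 / n) * (A w y - δ)
            = ∑ w, B x w * A w y - 1 / n * ∑ w, A w y - δ * ∑ w, B x w
              + ∑ _w : G, δ / n := by
          rw [Finset.mul_sum, Finset.mul_sum, ← Finset.sum_sub_distrib, ← Finset.sum_sub_distrib,
            ← Finset.sum_add_distrib]
          apply Finset.sum_congr rfl
          intro w _
          ring
        rw [this, hc, hr, mul_add, mul_one, pow_add, Matrix.mul_apply]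
        simp only [Finset.sum_const, Finset.card_univ, nsmul_eq_mul, ← hn]
        field_simp
        ring
      calc ∑ y : G, |(lazyCayleyP S ^ (T * (k + 1))) x y - 1 / n|
          ≤ ∑ y, ∑ w, |B x w - 1 / n| * (A w y - δ) := by
            apply Finset.sum_le_sum
            intro y _
            rw [e]
            refine (Finset.abs_sum_le_sum_abs _ _).trans (le_of_eq ?_)
            apply Finset.sum_congr rfl
            intro w _
            rw [abs_mul, abs_of_nonneg (sub_nonneg.mpr (hmin w y))]
        _ = ∑ w, |B x w - 1 / n| * (1 - n * δ) := by
            rw [Finset.sum_comm]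
            apply Finset.sum_congr rfl
            intro w _
            rw [← Finset.mul_sum, Finset.sum_sub_distrib, hA, pow_row_sum S h1 hne T w]
            simp [hn]
        _ ≤ (1 - n * δ) ^ (k + 1) * 2 := by
            rw [← Finset.sum_mul, pow_succ]
            have := mul_le_mul_of_nonneg_right (ih x) hδn
            linarith
  have hlt : 1 - n * δ < 1 := by have := mul_pos hnpos hδpos; linarith
  obtain ⟨k, hk⟩ := exists_pow_lt_of_lt_one (show (0 : ℝ) < 1 / 4 by norm_num) hlt
  refine ⟨T * k, fun x => ?_⟩
  have := key k x
  linarith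

theorem wordDist_le {G : Type*} [Group G] (S S' : Finset G) (hS : IsSymmGen S)
    (h : ∀ s ∈ S, ∃ l : List G, l.length ≤ 3 ∧ (∀ s ∈ l, s ∈ S') ∧ s = l.prod) (x y : G) :
    wordDist S' x y ≤ 3 * wordDist S x y := by
  have hne : {k : ℕ | ∃ l : List G, l.length = k ∧ (∀ s ∈ l, s ∈ S) ∧ x⁻¹ * y = l.prod}.Nonempty := by
    obtain ⟨l, hl, hp⟩ := exists_list_of_gen S hS (x⁻¹ * y)
    exact ⟨l.length, l, rfl, hl, hp⟩
  obtain ⟨l, hlen, hl, hp⟩ := Nat.sInf_mem hne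
  have key : ∀ l : List G, (∀ s ∈ l, s ∈ S) →
      ∃ l' : List G, l'.length ≤ 3 * l.length ∧ (∀ s ∈ l', s ∈ S') ∧ l.prod = l'.prod := by
    intro l
    induction l with
    | nil => intro _; exact ⟨[], by simp, by simp, rfl⟩
    | cons s l ih =>
      intro hsl
      obtain ⟨l1, a1, b1, c1⟩ := ih (fun s hs => hsl s (by simp [hs]))
      obtain ⟨l2, a2, b2, c2⟩ := h s (hsl s (by simp))
      refine ⟨l2 ++ l1, by simp; omega, ?_, by simp [c1, ← c2]⟩
      intro u hu
      rcases List.mem_append.mp hu with hu | hu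
      · exact b2 u hu
      · exact b1 u hu
  obtain ⟨l', a, b, c⟩ := key l hl
  calc wordDist S' x y ≤ l'.length := Nat.sInf_le ⟨l', rfl, b, hp.trans c⟩
    _ ≤ 3 * l.length := a
    _ = 3 * wordDist S x y := by rw [hlen]; rfl
section Star

open Equiv

variable {α : Type*} [Fintype α] [DecidableEq α]

/-- The star transpositions `(o i)`. -/
def starSet (o : α) : Finset (Perm α) := (univ.erase o).image (fun i => swap o i)

theorem swap_inj_right (o : α) : Function.Injective (fun i => swap o i) := by
  intro i j h
  have := congrArg (fun e : Perm α => e o) h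
  simpa using this

theorem card_starSet (o : α) : (starSet o).card = Fintype.card α - 1 := by
  rw [starSet, Finset.card_image_of_injective _ (swap_inj_right o)]
  simp

theorem mem_starSet {o : α} {s : Perm α} : s ∈ starSet o ↔ ∃ i, i ≠ o ∧ s = swap o i := by
  simp [starSet, eq_comm]

theorem one_notMem_starSet (o : α) : (1 : Perm α) ∉ starSet o := by
  rw [mem_starSet]
  rintro ⟨i, hi, h⟩
  have := congrArg (fun e : Perm α => e o) h
  simp at this
  exact hi this.symm

/-- Jump rate. -/
noncomputable def rate (α : Type*) [Fintype α] : ℝ := 1 / (2 * ((Fintype.card α : ℝ) - 1))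

theorem star_pow_step (o : α) (t : ℕ) (x z : Perm α) :
    (lazyCayleyP (starSet o) ^ (t + 1)) x z
      = (1 / 2 - rate α) * (lazyCayleyP (starSet o) ^ t) x z
        + rate α * ∑ i, (lazyCayleyP (starSet o) ^ t) (x * swap o i) z := by
  have hc : ((starSet o).card : ℝ) = (Fintype.card α : ℝ) - 1 := by
    rw [card_starSet, Nat.cast_sub (Fintype.card_pos_iff.mpr ⟨o⟩)]; simp
  rw [pow_step _ (one_notMem_starSet o), hc, starSet,
    Finset.sum_image (fun i _ j _ h => swap_inj_right o h),
    ← Finset.add_sum_erase univ _ (Finset.mem_univ o)]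
  simp only [swap_self, rate]
  have : x * Equiv.refl α = x := mul_one x
  rw [this]
  ring

/-- Coupling permutation. -/
def cpl (o : α) (x y : Perm α) : Perm α := if x o = y o then 1 else y⁻¹ * x

/-- The coupled generator. -/
noncomputable def Qop (o : α) (f : Perm α → Perm α → ℝ) (x y : Perm α) : ℝ :=
  (1 / 2 - rate α) * f x y + rate α * ∑ i, f (x * swap o i) (y * swap o (cpl o x y i))

noncomputable def hh (o : α) : ℕ → Perm α → Perm α → ℝ
  | 0 => fun x y => if x = y then 0 else 1
  | t + 1 => Qop o (hh o t)

theorem rate_pos (hn : 2 ≤ Fintype.card α) : 0 < rate α := by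
  have : (2 : ℝ) ≤ Fintype.card α := by exact_mod_cast hn
  unfold rate
  apply one_div_pos.mpr
  linarith

theorem rate_le (hn : 2 ≤ Fintype.card α) : 0 ≤ 1 / 2 - rate α := by
  have : (2 : ℝ) ≤ Fintype.card α := by exact_mod_cast hn
  unfold rate
  rw [sub_nonneg]
  apply one_div_le_one_div_of_le <;> linarith

theorem rate_mul (hn : 2 ≤ Fintype.card α) : rate α * Fintype.card α = 1 / 2 + rate α := by
  have : (2 : ℝ) ≤ Fintype.card α := by exact_mod_cast hn
  have h : (Fintype.card α : ℝ) - 1 ≠ 0 := by linarith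
  unfold rate
  field_simp
  ring

theorem Qop_mono (hn : 2 ≤ Fintype.card α) (o : α) {f g : Perm α → Perm α → ℝ}
    (h : ∀ x y, f x y ≤ g x y) (x y : Perm α) : Qop o f x y ≤ Qop o g x y := by
  unfold Qop
  have h1 := mul_le_mul_of_nonneg_left (h x y) (rate_le hn)
  have h2 := mul_le_mul_of_nonneg_left (Finset.sum_le_sum (s := univ) fun i _ =>
    h (x * swap o i) (y * swap o (cpl o x y i))) (rate_pos hn).le
  linarith

theorem hh_anti (hn : 2 ≤ Fintype.card α) (o : α) (t : ℕ) :
    ∀ x y, hh o (t + 1) x y ≤ hh o t x y := by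
  induction t with
  | zero =>
    intro x y
    by_cases hxy : x = y
    · subst hxy
      simp [hh, Qop, cpl]
    · have : ∑ i, hh o 0 (x * swap o i) (y * swap o (cpl o x y i)) ≤ ∑ _i : α, (1 : ℝ) := by
        apply Finset.sum_le_sum
        intro i _
        simp only [hh]
        split_ifs <;> norm_num
      have h2 := mul_le_mul_of_nonneg_left this (rate_pos hn).le
      simp only [Finset.sum_const, Finset.card_univ, nsmul_eq_mul, mul_one, rate_mul hn] at h2
      have h3 : hh o 0 x y = 1 := by simp [hh, hxy]
      change Qop o (hh o 0) x y ≤ _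
      unfold Qop
      rw [h3]
      linarith
  | succ t ih => exact fun x y => Qop_mono hn o ih x y

theorem hh_nonneg (hn : 2 ≤ Fintype.card α) (o : α) (t : ℕ) : ∀ x y, 0 ≤ hh o t x y := by
  induction t with
  | zero => intro x y; simp only [hh]; split_ifs <;> norm_num
  | succ t ih =>
    intro x y
    have a := rate_pos hn
    have b := rate_le hn
    have c := ih x y
    have d := Finset.sum_nonneg (s := univ) fun i _ => ih (x * swap o i) (y * swap o (cpl o x y i))
    change 0 ≤ Qop o (hh o t) x y
    unfold Qop
    positivity

/-- Coupling inequality. -/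
theorem tv_le_hh (hn : 2 ≤ Fintype.card α) (o : α) (t : ℕ) : ∀ x y : Perm α,
    ∑ z, |(lazyCayleyP (starSet o) ^ t) x z - (lazyCayleyP (starSet o) ^ t) y z|
      ≤ 2 * hh o t x y := by
  induction t with
  | zero =>
    intro x y
    by_cases hxy : x = y
    · simp [hxy, hh]
    · have : ∀ z, |((lazyCayleyP (starSet o)) ^ 0) x z - ((lazyCayleyP (starSet o)) ^ 0) y z|
          ≤ (if x = z then 1 else 0) + (if y = z then 1 else 0) := by
        intro z
        simp only [pow_zero, Matrix.one_apply]
        split_ifs <;> norm_num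
      refine (Finset.sum_le_sum fun z _ => this z).trans ?_
      rw [Finset.sum_add_distrib]
      simp [hh, hxy]
      norm_num
  | succ t ih =>
    intro x y
    set P := lazyCayleyP (starSet o) with hP
    have e : ∀ z, |(P ^ (t + 1)) x z - (P ^ (t + 1)) y z|
        ≤ (1 / 2 - rate α) * |(P ^ t) x z - (P ^ t) y z|
          + rate α * ∑ i, |(P ^ t) (x * swap o i) z - (P ^ t) (y * swap o (cpl o x y i)) z| := by
      intro z
      have hy : ∑ i, (P ^ t) (y * swap o i) z = ∑ i, (P ^ t) (y * swap o (cpl o x y i)) z :=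
        (Equiv.sum_comp (cpl o x y) (fun i => (P ^ t) (y * swap o i) z)).symm
      rw [hP, star_pow_step, star_pow_step, ← hP, hy]
      have : (1 / 2 - rate α) * (P ^ t) x z + rate α * ∑ i, (P ^ t) (x * swap o i) z
          - ((1 / 2 - rate α) * (P ^ t) y z + rate α * ∑ i, (P ^ t) (y * swap o (cpl o x y i)) z)
          = (1 / 2 - rate α) * ((P ^ t) x z - (P ^ t) y z)
          + rate α * ∑ i, ((P ^ t) (x * swap o i) z - (P ^ t) (y * swap o (cpl o x y i)) z) := by
        rw [Finset.sum_sub_distrib]; ring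
      rw [this]
      refine (abs_add_le _ _).trans ?_
      rw [abs_mul, abs_mul, abs_of_nonneg (rate_le hn), abs_of_pos (rate_pos hn)]
      have := mul_le_mul_of_nonneg_left (Finset.abs_sum_le_sum_abs
        (fun i => (P ^ t) (x * swap o i) z - (P ^ t) (y * swap o (cpl o x y i)) z) univ)
        (rate_pos hn).le
      linarith
    refine (Finset.sum_le_sum fun z _ => e z).trans ?_
    rw [Finset.sum_add_distrib, ← Finset.mul_sum, ← Finset.mul_sum, Finset.sum_comm]
    change _ ≤ 2 * Qop o (hh o t) x y
    unfold Qop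
    have h1 := mul_le_mul_of_nonneg_left (ih x y) (rate_le hn)
    have h2 := mul_le_mul_of_nonneg_left (Finset.sum_le_sum (s := univ) fun i _ =>
      ih (x * swap o i) (y * swap o (cpl o x y i))) (rate_pos hn).le
    rw [← Finset.mul_sum] at h2
    linarith

/-- Potential profile. -/
noncomputable def Apot (α : Type*) [Fintype α] (k : ℕ) : ℝ :=
  4 * (Fintype.card α : ℝ) ^ 2 * (1 - 1 / (k : ℝ))

/-- Number of positions where the decks differ. -/
def dif (x y : Perm α) : ℕ := (y⁻¹ * x).support.card

/-- Potential. -/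
noncomputable def Wpot (o : α) (x y : Perm α) : ℝ :=
  if x = y then 0 else Apot α (dif x y) - if x o = y o then 0 else 1 / (rate α * dif x y)

theorem mem_supp (x y : Perm α) (i : α) : i ∈ (y⁻¹ * x).support ↔ x i ≠ y i := by
  rw [Perm.mem_support, Perm.mul_apply, Ne, Perm.inv_eq_iff_eq]

theorem two_le_dif {x y : Perm α} (h : x ≠ y) : 2 ≤ dif x y := by
  apply Perm.two_le_card_support_of_ne_one
  intro h'
  exact h (inv_mul_eq_one.mp h').symm

theorem dif_le (x y : Perm α) : dif x y ≤ Fintype.card α := Finset.card_le_univ _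

theorem dif_conj (x y s : Perm α) : dif (x * s) (y * s) = dif x y := by
  unfold dif
  have : (y * s)⁻¹ * (x * s) = s⁻¹ * (y⁻¹ * x) * (s⁻¹)⁻¹ := by group
  rw [this, Perm.card_support_conj]

theorem dif_decr (o : α) (x y : Perm α) (ho : x o ≠ y o) (i : α) (hi : x i ≠ y i) :
    dif (x * swap o i) (y * swap o (y⁻¹ (x i))) ≤ dif x y - 1 := by
  unfold dif
  rw [← Finset.card_erase_of_mem ((mem_supp x y o).mpr ho)]
  apply Finset.card_le_card
  intro j hj
  rw [mem_supp] at hj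
  rw [Finset.mem_erase, mem_supp]
  have hjo : j ≠ o := by
    rintro rfl
    simp at hj
  refine ⟨hjo, ?_⟩
  by_cases hji : j = i
  · subst hji; exact hi
  · by_cases hjq : j = y⁻¹ (x i)
    · intro h
      have : y j = x i := by rw [hjq]; simp
      exact hji (x.injective (h.trans this))
    · rwa [Perm.mul_apply, Perm.mul_apply, swap_apply_of_ne_of_ne hjo hji,
        swap_apply_of_ne_of_ne hjo hjq] at hj

theorem Apot_mono {j k : ℕ} (hj : 1 ≤ j) (hjk : j ≤ k) : Apot α j ≤ Apot α k := by
  unfold Apot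
  have h1 : (1 : ℝ) ≤ j := by exact_mod_cast hj
  have h2 : (j : ℝ) ≤ k := by exact_mod_cast hjk
  have := one_div_le_one_div_of_le (by linarith) h2
  gcongr

theorem Apot_nonneg {k : ℕ} (hk : 1 ≤ k) : 0 ≤ Apot α k := by
  have := Apot_mono (α := α) le_rfl hk
  simp [Apot] at this ⊢
  exact this

theorem Apot_le (k : ℕ) : Apot α k ≤ 4 * (Fintype.card α : ℝ) ^ 2 := by
  unfold Apot
  have : 0 ≤ 1 / (k : ℝ) := by positivity
  have h : 0 ≤ 4 * (Fintype.card α : ℝ) ^ 2 := by positivity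
  nlinarith

theorem Apot_step (hn : 2 ≤ Fintype.card α) {k : ℕ} (hk : 2 ≤ k) (hkn : k ≤ Fintype.card α) :
    (Fintype.card α : ℝ) / k + 1 ≤ rate α * k * (Apot α k - Apot α (k - 1)) := by
  unfold Apot rate
  have h1 : (2 : ℝ) ≤ k := by exact_mod_cast hk
  have h2 : (k : ℝ) ≤ (Fintype.card α : ℝ) := by exact_mod_cast hkn
  set n : ℝ := (Fintype.card α : ℝ)
  rw [Nat.cast_sub (by omega), Nat.cast_one]
  have h3 : (0 : ℝ) < k - 1 := by linarith
  have h4 : (0 : ℝ) < n - 1 := by linarith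
  have e : 1 / (2 * (n - 1)) * k * (4 * n ^ 2 * (1 - 1 / (k : ℝ)) - 4 * n ^ 2 * (1 - 1 / ((k : ℝ) - 1)))
      = 2 * n ^ 2 / ((n - 1) * (k - 1)) := by
    field_simp
    ring
  rw [e]
  have a1 : n / k + 1 ≤ 2 * n / k := by
    rw [le_div_iff₀ (by linarith)]
    field_simp
    linarith
  have a2 : 2 * n / k ≤ 2 * n ^ 2 / ((n - 1) * (k - 1)) := by
    rw [div_le_div_iff₀ (by linarith) (by positivity)]
    have : (n - 1) * (k - 1) ≤ n * k := by nlinarith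
    nlinarith
  linarith

theorem W_nonneg (hn : 2 ≤ Fintype.card α) (o : α) (x y : Perm α) : 0 ≤ Wpot o x y := by
  unfold Wpot
  split_ifs with h h'
  · exact le_rfl
  · have := two_le_dif h
    have := Apot_nonneg (α := α) (k := dif x y) (by omega)
    linarith
  · have h2 := two_le_dif h
    have h3 := Apot_step hn h2 (dif_le x y)
    have h4 := Apot_nonneg (α := α) (k := dif x y - 1) (by omega)
    have h5 : (2 : ℝ) ≤ dif x y := by exact_mod_cast h2
    have hr := rate_pos hn
    rw [sub_nonneg, div_le_iff₀ (by positivity)]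
    have h6 : 0 ≤ (Fintype.card α : ℝ) / dif x y := by positivity
    have h7 : 0 ≤ rate α * dif x y * Apot α (dif x y - 1) := by positivity
    linarith

theorem W_le (hn : 2 ≤ Fintype.card α) (o : α) (x y : Perm α) :
    Wpot o x y ≤ 4 * (Fintype.card α : ℝ) ^ 2 := by
  have hr := rate_pos hn
  have := Apot_le (α := α) (dif x y)
  unfold Wpot
  split_ifs with h h'
  · positivity
  · linarith
  · have : 0 ≤ 1 / (rate α * dif x y) := by positivity
    linarith

theorem W_drift (hn : 2 ≤ Fintype.card α) (o : α) (x y : Perm α) :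
    hh o 0 x y + Qop o (Wpot o) x y ≤ Wpot o x y := by
  have hr := rate_pos hn
  by_cases hxy : x = y
  · subst hxy
    simp [hh, Qop, cpl, Wpot]
  have h2 := two_le_dif hxy
  have hkn := dif_le x y
  have h5 : (2 : ℝ) ≤ dif x y := by exact_mod_cast h2
  have hcard : ∑ i, (if x i = y i then (0 : ℝ) else 1) = dif x y := by
    have : ∀ i, (if x i = y i then (0 : ℝ) else 1) = if i ∈ (y⁻¹ * x).support then 1 else 0 := by
      intro i
      simp only [mem_supp]
      by_cases h : x i = y i <;> simp [h]
    rw [Finset.sum_congr rfl fun i _ => this i, Finset.sum_ite_mem, Finset.univ_inter]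
    simp only [Finset.sum_const, nsmul_eq_mul, mul_one, dif]
  have h0 : hh o 0 x y = 1 := by simp [hh, hxy]
  rw [h0]
  unfold Qop
  suffices hs : rate α * ∑ i, Wpot o (x * swap o i) (y * swap o (cpl o x y i))
      ≤ (1 / 2 + rate α) * Wpot o x y - 1 by linarith
  rw [← rate_mul hn]
  by_cases ho : x o = y o
  · have e : ∀ i, Wpot o (x * swap o i) (y * swap o (cpl o x y i))
        = Wpot o x y - (1 / (rate α * dif x y)) * (if x i = y i then (0 : ℝ) else 1) := by
      intro i
      have hc : cpl o x y i = i := by simp [cpl, ho]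
      rw [hc]
      unfold Wpot
      have hne : x * swap o i ≠ y * swap o i := fun h => hxy (mul_right_cancel h)
      rw [if_neg hne, if_neg hxy, dif_conj, if_pos ho]
      simp only [Perm.mul_apply, swap_apply_left]
      split_ifs <;> ring
    rw [Finset.sum_congr rfl fun i _ => e i, Finset.sum_sub_distrib, ← Finset.mul_sum, hcard]
    simp only [Finset.sum_const, Finset.card_univ, nsmul_eq_mul]
    apply le_of_eq
    field_simp
  · have e : ∀ i, Wpot o (x * swap o i) (y * swap o (cpl o x y i))
        ≤ Apot α (dif x y) - (Apot α (dif x y) - Apot α (dif x y - 1)) *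
            (if x i = y i then (0 : ℝ) else 1) := by
      intro i
      have hc : cpl o x y i = y⁻¹ (x i) := by simp [cpl, ho]
      rw [hc]
      have htop : (x * swap o i) o = (y * swap o (y⁻¹ (x i))) o := by simp
      by_cases hi : x i = y i
      · have : y⁻¹ (x i) = i := by rw [hi]; simp
        rw [this] at htop ⊢
        have hne : x * swap o i ≠ y * swap o i := fun h => hxy (mul_right_cancel h)
        unfold Wpot
        rw [if_neg hne, dif_conj, if_pos htop]
        simp [hi]
      · have hd := dif_decr o x y ho i hi
        rw [if_neg hi]
        unfold Wpot
        rw [if_pos htop]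
        split_ifs with hne
        · have := Apot_nonneg (α := α) (k := dif x y - 1) (by omega)
          linarith
        · have := two_le_dif hne
          have := Apot_mono (α := α) (by omega) hd
          linarith
    have hs := mul_le_mul_of_nonneg_left (Finset.sum_le_sum (s := univ) fun i _ => e i) hr.le
    rw [Finset.sum_sub_distrib, ← Finset.mul_sum, hcard] at hs
    simp only [Finset.sum_const, Finset.card_univ, nsmul_eq_mul] at hs
    refine hs.trans ?_
    have hst := Apot_step hn h2 hkn
    unfold Wpot
    rw [if_neg hxy, if_neg ho]
    have : rate α * (Fintype.card α : ℝ) * (Apot α (dif x y) - 1 / (rate α * dif x y))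
        = rate α * (Fintype.card α : ℝ) * Apot α (dif x y) - (Fintype.card α : ℝ) / dif x y := by
      field_simp
    rw [this]
    linarith

theorem sum_hh_le (hn : 2 ≤ Fintype.card α) (o : α) (t : ℕ) : ∀ x y : Perm α,
    ∑ s ∈ range t, hh o s x y ≤ Wpot o x y := by
  induction t with
  | zero => intro x y; simpa using W_nonneg hn o x y
  | succ t ih =>
    intro x y
    refine le_trans ?_ (W_drift hn o x y)
    rw [Finset.sum_range_succ', add_comm]
    refine add_le_add le_rfl ?_
    refine le_trans (le_of_eq ?_) (Qop_mono hn o ih x y)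
    simp only [hh, Qop]
    rw [Finset.sum_add_distrib, ← Finset.mul_sum, ← Finset.mul_sum, Finset.sum_comm]

theorem hh_le (hn : 2 ≤ Fintype.card α) (o : α) (t : ℕ) (x y : Perm α) :
    (t : ℝ) * hh o t x y ≤ 4 * (Fintype.card α : ℝ) ^ 2 := by
  refine le_trans ?_ ((sum_hh_le hn o t x y).trans (W_le hn o x y))
  have hanti : Antitone (fun s => hh o s x y) := antitone_nat_of_succ_le fun s => hh_anti hn o s x y
  have : ∑ _s ∈ range t, hh o t x y ≤ ∑ s ∈ range t, hh o s x y :=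
    Finset.sum_le_sum fun s hs => hanti (Finset.mem_range.mp hs).le
  simpa using this

theorem star_mix_le (hn : 2 ≤ Fintype.card α) (o : α) :
    tvMixUnif (lazyCayleyP (starSet o)) ≤ 16 * (Fintype.card α) ^ 2 := by
  apply Nat.sInf_le
  intro x
  set t := 16 * (Fintype.card α) ^ 2 with ht
  set P := lazyCayleyP (starSet o) with hP
  set M : ℝ := (Fintype.card (Perm α) : ℝ) with hM
  have hMpos : 0 < M := by rw [hM]; exact_mod_cast Fintype.card_pos
  have hn' : (2 : ℝ) ≤ Fintype.card α := by exact_mod_cast hn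
  have hh4 : ∀ y, hh o t x y ≤ 1 / 4 := by
    intro y
    have := hh_le hn o t x y
    rw [ht] at this
    push_cast at this
    have hp : (0 : ℝ) < (Fintype.card α : ℝ) ^ 2 := by positivity
    rw [← ht] at this
    nlinarith
  have hinv : ∀ s ∈ starSet o, s⁻¹ ∈ starSet o := by
    intro s hs
    obtain ⟨i, hi, rfl⟩ := mem_starSet.mp hs
    simpa using hs
  have hne : (starSet o).Nonempty := by
    rw [← Finset.card_pos, card_starSet]; omega
  have e : ∀ z, |(P ^ t) x z - 1 / M| ≤ 1 / M * ∑ y, |(P ^ t) x z - (P ^ t) y z| := by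
    intro z
    have hc := pow_col_sum (starSet o) (one_notMem_starSet o) hinv hne t z
    rw [← hP] at hc
    have : (P ^ t) x z - 1 / M = 1 / M * ∑ y, ((P ^ t) x z - (P ^ t) y z) := by
      rw [Finset.sum_sub_distrib, hc]
      simp only [Finset.sum_const, Finset.card_univ, nsmul_eq_mul, ← hM]
      field_simp
    rw [this, abs_mul, abs_of_pos (by positivity : 0 < 1 / M)]
    exact mul_le_mul_of_nonneg_left (Finset.abs_sum_le_sum_abs _ _) (by positivity)
  have h1 : ∑ z, |(P ^ t) x z - 1 / M| ≤ 1 / M * ∑ _y : Perm α, (1 / 2 : ℝ) := by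
    refine (Finset.sum_le_sum fun z _ => e z).trans ?_
    rw [← Finset.mul_sum, Finset.sum_comm]
    refine mul_le_mul_of_nonneg_left (Finset.sum_le_sum fun y _ => ?_) (by positivity)
    have := tv_le_hh hn o t x y
    have := hh4 y
    linarith
  simp only [Finset.sum_const, Finset.card_univ, nsmul_eq_mul, ← hM] at h1
  have : 1 / M * (M * (1 / 2)) = 1 / 2 := by field_simp
  linarith

end Star

section Lower

open Equiv

variable {α : Type*} [Fintype α] [DecidableEq α]

theorem bern_pow (w d : ℝ) (hw : 0 ≤ w) (hd : 0 ≤ d) (a : ℕ) :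
    w ^ a + a * w ^ (a - 1) * d ≤ (w + d) ^ a := by
  induction a with
  | zero => simp
  | succ a ih =>
    rw [pow_succ (w + d)]
    have h1 := mul_le_mul_of_nonneg_right ih (add_nonneg hw hd)
    refine le_trans ?_ h1
    rcases Nat.eq_zero_or_pos a with rfl | ha
    · simp
    · obtain ⟨b, rfl⟩ : ∃ b, a = b + 1 := ⟨a - 1, by omega⟩
      simp only [Nat.add_sub_cancel]
      push_cast
      have : 0 ≤ ((b : ℝ) + 1) * w ^ b * d * d := by positivity
      ring_nf at this ⊢
      linarith

/-- Indicator that no point of `B` is fixed. -/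
def noFix (B : Finset α) (g : Perm α) : ℝ := if ∃ i ∈ B, g i = i then 0 else 1

theorem noFix_decay (S : Finset (Perm α)) (h1 : (1 : Perm α) ∉ S) (hne : S.Nonempty)
    (o : α) (B : Finset α) (ho : o ∉ B)
    (hB : ∀ s ∈ S, ∀ i ∈ B, s i ≠ i → s = swap o i) (t : ℕ) :
    ∀ (A : Finset α), A ⊆ B → ∀ g : Perm α, (∀ i ∈ A, g i = i) →
      ∑ y, (lazyCayleyP S ^ t) g y * noFix B y
        ≤ (1 - (1 - 1 / (2 * (S.card : ℝ))) ^ t) ^ A.card := by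
  have hN : (1 : ℝ) ≤ S.card := by exact_mod_cast Finset.card_pos.mpr hne
  set N : ℝ := (S.card : ℝ) with hNdef
  have hp : 0 < 1 / (2 * N) := by positivity
  have hp1 : 1 / (2 * N) ≤ 1 / 2 := by
    apply one_div_le_one_div_of_le <;> linarith
  set p := 1 / (2 * N) with hpdef
  have hNp : N * p = 1 / 2 := by rw [hpdef]; field_simp
  induction t with
  | zero =>
    intro A hA g hg
    simp only [pow_zero, Matrix.one_apply, ite_mul, one_mul, zero_mul, Finset.sum_ite_eq,
      Finset.mem_univ, if_true, sub_self]
    rcases A.eq_empty_or_nonempty with rfl | ⟨i, hi⟩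
    · simp only [Finset.card_empty, pow_zero, noFix]
      split_ifs <;> norm_num
    · have : noFix B g = 0 := by
        unfold noFix
        rw [if_pos ⟨i, hA hi, hg i hi⟩]
      rw [this]
      positivity
  | succ t ih =>
    intro A hA g hg
    set E : Perm α → ℝ := fun x => ∑ y, (lazyCayleyP S ^ t) x y * noFix B y with hE
    have hq0 : 0 ≤ (1 - p) ^ t := pow_nonneg (by linarith) t
    have hq1 : (1 - p) ^ t ≤ 1 := pow_le_one₀ (by linarith) (by linarith)
    set w := 1 - (1 - p) ^ t with hw
    have hw0 : 0 ≤ w := by linarith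
    have hw1 : w ≤ 1 := by linarith
    have e1 : ∑ y, (lazyCayleyP S ^ (t + 1)) g y * noFix B y
        = 1 / 2 * E g + p * ∑ s ∈ S, E (g * s) := by
      simp_rw [pow_step S h1, add_mul, Finset.sum_add_distrib, hE]
      rw [Finset.mul_sum, Finset.sum_comm, Finset.mul_sum]
      congr 1
      · apply Finset.sum_congr rfl; intro y _; ring
      · apply Finset.sum_congr rfl; intro y _
        rw [← Finset.sum_mul]; ring
    rw [e1]
    set a := A.card with ha
    set T := A.image (fun i => swap o i) with hT
    have hTc : T.card ≤ a := Finset.card_image_le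
    have hd : 0 ≤ w ^ (a - 1) - w ^ a := by
      have := pow_le_pow_of_le_one hw0 hw1 (Nat.sub_le a 1)
      linarith
    have hEs : ∀ s ∈ S, E (g * s) ≤ w ^ a + if s ∈ T then w ^ (a - 1) - w ^ a else 0 := by
      intro s hs
      split_ifs with hsT
      · obtain ⟨i, hi, rfl⟩ := Finset.mem_image.mp hsT
        have := ih (A.erase i) ((Finset.erase_subset _ _).trans hA) (g * swap o i) (by
          intro j hj
          have hj' := Finset.mem_erase.mp hj
          have hjo : j ≠ o := fun h => ho (h ▸ hA hj'.2)
          rw [Perm.mul_apply, swap_apply_of_ne_of_ne hjo hj'.1]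
          exact hg j hj'.2)
        rw [Finset.card_erase_of_mem hi] at this
        simpa using this
      · have := ih A hA (g * s) (by
          intro j hj
          have : s j = j := by
            by_contra h
            exact hsT (Finset.mem_image.mpr ⟨j, hj, (hB s hs j (hA hj) h).symm⟩)
          rw [Perm.mul_apply, this]
          exact hg j hj)
        simpa using this
    have hsum : ∑ s ∈ S, E (g * s) ≤ N * w ^ a + a * (w ^ (a - 1) - w ^ a) := by
      refine (Finset.sum_le_sum hEs).trans ?_
      rw [Finset.sum_add_distrib, Finset.sum_ite_mem]
      simp only [Finset.sum_const, nsmul_eq_mul]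
      have : ((S ∩ T).card : ℝ) ≤ a := by
        exact_mod_cast (Finset.card_le_card Finset.inter_subset_right).trans hTc
      have := mul_le_mul_of_nonneg_right this hd
      linarith
    have hEg : E g ≤ w ^ a := ih A hA g hg
    have hb := bern_pow w (p * (1 - w)) hw0 (mul_nonneg hp.le (by linarith)) a
    have hw' : 1 - (1 - p) ^ (t + 1) = w + p * (1 - w) := by rw [hw, pow_succ]; ring
    rw [hw']
    refine le_trans ?_ hb
    have hs2 := mul_le_mul_of_nonneg_left hsum hp.le
    have hid : (a : ℝ) * w ^ (a - 1) * (p * (1 - w)) = p * (a * (w ^ (a - 1) - w ^ a)) := by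
      rcases Nat.eq_zero_or_pos a with h0 | h0
      · simp [h0]
      · obtain ⟨b, hb⟩ : ∃ b, a = b + 1 := ⟨a - 1, by omega⟩
        rw [hb]
        simp only [Nat.add_sub_cancel]
        ring
    rw [hid]
    have : p * (N * w ^ a) = 1 / 2 * w ^ a := by rw [← mul_assoc, mul_comm p N, hNp]
    rw [mul_add, this] at hs2
    linarith

theorem card_fix (i : α) :
    Fintype.card α * (univ.filter (fun g : Perm α => g i = i)).card = Fintype.card (Perm α) := by
  have h : (univ : Finset (Perm α)).card
      = ∑ j : α, (univ.filter (fun g : Perm α => g i = j)).card :=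
    Finset.card_eq_sum_card_fiberwise (f := fun g : Perm α => g i) (fun _ _ => by simp)
  rw [← Finset.card_univ (α := Perm α), h]
  have : ∀ j : α, (univ.filter (fun g : Perm α => g i = j)).card
      = (univ.filter (fun g : Perm α => g i = i)).card := by
    intro j
    refine Finset.card_bij' (fun g _ => swap i j * g) (fun g _ => swap i j * g) ?_ ?_ ?_ ?_
    · intro g hg; simp at hg ⊢; simp [hg]
    · intro g hg; simp at hg ⊢; simp [hg]
    · intro g _; simp [← mul_assoc]
    · intro g _; simp [← mul_assoc]
  rw [Finset.sum_congr rfl fun j _ => this j]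
  simp

theorem noFix_unif (B : Finset α) (hB : 2 * B.card ≤ Fintype.card α) (hα : 0 < Fintype.card α) :
    (Fintype.card (Perm α) : ℝ) / 2 ≤ ∑ g : Perm α, noFix B g := by
  have h1 : ∀ g : Perm α, 1 - ∑ i ∈ B, (if g i = i then (1 : ℝ) else 0) ≤ noFix B g := by
    intro g
    unfold noFix
    split_ifs with h
    · obtain ⟨i, hi, hgi⟩ := h
      have := Finset.single_le_sum (f := fun i => if g i = i then (1 : ℝ) else 0)
        (fun j _ => by split_ifs <;> norm_num) hi
      simp only [hgi, if_true] at this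
      linarith
    · have : 0 ≤ ∑ i ∈ B, (if g i = i then (1 : ℝ) else 0) :=
        Finset.sum_nonneg (fun j _ => by split_ifs <;> norm_num)
      linarith
  refine le_trans ?_ (Finset.sum_le_sum fun g _ => h1 g)
  rw [Finset.sum_sub_distrib, Finset.sum_comm]
  have hn : (0 : ℝ) < Fintype.card α := by exact_mod_cast hα
  have h2 : ∀ i ∈ B, ∑ g : Perm α, (if g i = i then (1 : ℝ) else 0)
      = (Fintype.card (Perm α) : ℝ) / Fintype.card α := by
    intro i _
    rw [← Finset.sum_filter, Finset.sum_const, nsmul_eq_mul, mul_one, eq_div_iff hn.ne']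
    rw [mul_comm]
    exact_mod_cast card_fix i
  rw [Finset.sum_congr rfl h2]
  simp only [Finset.sum_const, nsmul_eq_mul, mul_one, Finset.card_univ]
  have h3 : (2 : ℝ) * B.card ≤ Fintype.card α := by exact_mod_cast hB
  set M : ℝ := (Fintype.card (Perm α) : ℝ)
  have hM : 0 ≤ M := by positivity
  have : (B.card : ℝ) * (M / Fintype.card α) ≤ M / 2 := by
    rw [← mul_div_assoc, div_le_div_iff₀ hn (by norm_num)]
    nlinarith
  linarith

theorem tv_lower {G : Type*} [Fintype G] [Nonempty G] (v f : G → ℝ) (hv : ∑ y, v y = 1)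
    (hf0 : ∀ y, 0 ≤ f y) (hf1 : ∀ y, f y ≤ 1)
    (hu : (Fintype.card G : ℝ) / 2 ≤ ∑ y, f y) (hs : ∑ y, v y * f y < 1 / 4) :
    1 / 4 < (∑ y, |v y - 1 / (Fintype.card G : ℝ)|) / 2 := by
  have hM : (0 : ℝ) < Fintype.card G := by exact_mod_cast Fintype.card_pos
  set M : ℝ := (Fintype.card G : ℝ) with hMd
  have h1 : ∑ y, (1 / M - v y) * (f y - 1 / 2) ≤ ∑ y, |v y - 1 / M| * (1 / 2) := by
    apply Finset.sum_le_sum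
    intro y _
    refine (le_abs_self _).trans ?_
    rw [abs_mul, abs_sub_comm]
    refine mul_le_mul_of_nonneg_left ?_ (abs_nonneg _)
    rw [abs_le]
    constructor <;> linarith [hf0 y, hf1 y]
  have h2 : ∑ y, (1 / M - v y) * (f y - 1 / 2)
      = 1 / M * ∑ y, f y - ∑ y, v y * f y - (∑ _y : G, 1 / M - ∑ y, v y) * (1 / 2) := by
    rw [Finset.mul_sum, ← Finset.sum_sub_distrib, ← Finset.sum_sub_distrib, Finset.sum_mul,
      ← Finset.sum_sub_distrib]
    apply Finset.sum_congr rfl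
    intro y _
    ring
  rw [h2, hv, ← Finset.sum_mul] at h1
  simp only [Finset.sum_const, Finset.card_univ, nsmul_eq_mul, ← hMd] at h1
  have h3 : M * (1 / M) = 1 := by field_simp
  rw [h3] at h1
  have h4 : 1 / 2 ≤ 1 / M * ∑ y, f y := by
    rw [one_div_mul_eq_div, le_div_iff₀ hM]
    linarith
  linarith

theorem lower_mix (S : Finset (Perm α)) (hS : IsSymmGen S) (hne : S.Nonempty)
    (o : α) (B : Finset α) (ho : o ∉ B)
    (hB : ∀ s ∈ S, ∀ i ∈ B, s i ≠ i → s = swap o i) (hB2 : 2 * B.card ≤ Fintype.card α)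
    (L : ℝ) (hL : 2 * Real.exp L ≤ B.card) :
    (S.card : ℝ) * L ≤ tvMixUnif (lazyCayleyP S) := by
  have h1 := hS.1
  have hmem := Nat.sInf_mem (show {t : ℕ | ∀ x : Perm α,
      (∑ y, |(lazyCayleyP S ^ t) x y - 1 / (Fintype.card (Perm α) : ℝ)|) / 2 ≤ 1 / 4}.Nonempty
    from mix_set_nonempty S hS hne)
  change ∀ x : Perm α, (∑ y, |(lazyCayleyP S ^ (tvMixUnif (lazyCayleyP S))) x y
    - 1 / (Fintype.card (Perm α) : ℝ)|) / 2 ≤ 1 / 4 at hmem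
  set t := tvMixUnif (lazyCayleyP S)
  by_contra hlt
  push Not at hlt
  have hN : (1 : ℝ) ≤ S.card := by exact_mod_cast Finset.card_pos.mpr hne
  have hdec := noFix_decay S h1 hne o B ho hB t B (le_refl _)
  set N : ℝ := (S.card : ℝ) with hNdef
  set b : ℝ := (B.card : ℝ) with hb
  have hp : 0 < 1 / (2 * N) := by positivity
  have hp1 : 1 / (2 * N) ≤ 1 / 2 := by
    apply one_div_le_one_div_of_le <;> linarith
  have hfin : ∑ y, (lazyCayleyP S ^ t) 1 y * noFix B y < 1 / 4 := by
    have hstart : ∑ y, (lazyCayleyP S ^ t) 1 y * noFix B y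
        ≤ (1 - (1 - 1 / (2 * N)) ^ t) ^ B.card := hdec 1 (by simp)
    refine hstart.trans_lt ?_
    set p := 1 / (2 * N) with hpd
    have hq : Real.exp (-(2 * p)) ≤ 1 - p := by
      have h3 := Real.add_one_le_exp (2 * p)
      rw [Real.exp_neg]
      rw [inv_le_iff_one_le_mul₀ (Real.exp_pos _)]
      nlinarith
    have hqt : Real.exp (-L) ≤ (1 - p) ^ t := by
      refine le_trans ?_ (pow_le_pow_left₀ (Real.exp_pos _).le hq t)
      rw [← Real.exp_nat_mul, Real.exp_le_exp]
      have h2p : 2 * p = 1 / N := by rw [hpd]; field_simp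
      rw [h2p]
      have : (t : ℝ) / N ≤ L := by rw [div_le_iff₀ (by linarith)]; linarith
      have h5 : (t : ℝ) * -(1 / N) = - ((t : ℝ) / N) := by ring
      rw [h5]; linarith
    have hq1 : (1 - p) ^ t ≤ 1 := pow_le_one₀ (by linarith) (by linarith)
    have h6 : 1 - (1 - p) ^ t ≤ Real.exp (-Real.exp (-L)) := by
      have := Real.add_one_le_exp (-Real.exp (-L))
      linarith
    refine (pow_le_pow_left₀ (by linarith) h6 _).trans_lt ?_
    rw [← Real.exp_nat_mul, ← hb]
    have h7 : 2 ≤ b * Real.exp (-L) := by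
      have := mul_le_mul_of_nonneg_right hL (Real.exp_pos (-L)).le
      rw [mul_assoc, ← Real.exp_add] at this
      simpa using this
    have h8 : b * -Real.exp (-L) ≤ -2 := by linarith
    refine (Real.exp_le_exp.mpr h8).trans_lt ?_
    have h9 : (4 : ℝ) < Real.exp 2 := by
      have := Real.exp_one_gt_d9
      have e : Real.exp 2 = Real.exp 1 * Real.exp 1 := by rw [← Real.exp_add]; norm_num
      rw [e]; nlinarith
    rw [Real.exp_neg, inv_lt_comm₀ (Real.exp_pos _) (by norm_num)]
    linarith
  have hcontra := tv_lower (fun y => (lazyCayleyP S ^ t) 1 y) (noFix B)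
    (pow_row_sum S h1 hne t 1)
    (fun y => by unfold noFix; split_ifs <;> norm_num)
    (fun y => by unfold noFix; split_ifs <;> norm_num)
    (noFix_unif B hB2 (Fintype.card_pos_iff.mpr ⟨o⟩)) hfin
  have := hmem 1
  linarith

theorem star_list (o i j : α) (hij : i ≠ j) :
    ∃ l : List (Perm α), l.length ≤ 3 ∧ (∀ s ∈ l, s ∈ starSet o) ∧ swap i j = l.prod := by
  by_cases hi : i = o
  · subst hi
    exact ⟨[swap i j], by simp, by simpa using mem_starSet.mpr ⟨j, hij.symm, rfl⟩, by simp⟩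
  by_cases hj : j = o
  · subst hj
    refine ⟨[swap j i], by simp, by simpa using mem_starSet.mpr ⟨i, hi, rfl⟩, ?_⟩
    simp [swap_comm]
  · refine ⟨[swap o j, swap o i, swap o j], by simp, ?_, ?_⟩
    · intro s hs
      simp only [List.mem_cons, List.not_mem_nil, or_false] at hs
      rcases hs with rfl | rfl | rfl
      · exact mem_starSet.mpr ⟨j, hj, rfl⟩
      · exact mem_starSet.mpr ⟨i, hi, rfl⟩
      · exact mem_starSet.mpr ⟨j, hj, rfl⟩
    · have := swap_mul_swap_mul_swap (x := i) (y := o) (z := j) hi hij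
      simp only [List.prod_cons, List.prod_nil, mul_one]
      rw [swap_comm i j, ← this, swap_comm i o, mul_assoc]

theorem symmGen_of_star (o : α) (S : Finset (Perm α)) (hS : ∀ s ∈ S, s.IsSwap)
    (hsub : starSet o ⊆ S) : IsSymmGen S := by
  refine ⟨?_, ?_, ?_⟩
  · intro h
    obtain ⟨i, j, hij, h⟩ := hS 1 h
    have := congrArg (fun e : Perm α => e i) h
    simp at this
    exact hij this
  · intro s hs
    obtain ⟨i, j, hij, rfl⟩ := hS s hs
    simpa using hs
  · rw [eq_top_iff, ← Perm.closure_isSwap, Subgroup.closure_le]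
    rintro s ⟨i, j, hij, rfl⟩
    obtain ⟨l, -, hl, hp⟩ := star_list o i j hij
    rw [hp]
    apply Subgroup.list_prod_mem
    intro s hs
    exact Subgroup.subset_closure (by exact_mod_cast hsub (hl s hs))

/-- The star together with a complete bipartite graph between `L₁` and `L₂`. -/
def bigSet (o : α) (L₁ L₂ : Finset α) : Finset (Perm α) :=
  starSet o ∪ (L₁ ×ˢ L₂).image (fun p => swap p.1 p.2)

theorem isSwap_star (o : α) : ∀ s ∈ starSet o, s.IsSwap := by
  intro s hs
  obtain ⟨i, hi, rfl⟩ := mem_starSet.mp hs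
  exact ⟨o, i, hi.symm, rfl⟩

theorem isSwap_big (o : α) (L₁ L₂ : Finset α) (hd : Disjoint L₁ L₂) :
    ∀ s ∈ bigSet o L₁ L₂, s.IsSwap := by
  intro s hs
  rcases Finset.mem_union.mp hs with hs | hs
  · exact isSwap_star o s hs
  · obtain ⟨p, hp, rfl⟩ := Finset.mem_image.mp hs
    rw [Finset.mem_product] at hp
    exact ⟨p.1, p.2, Finset.disjoint_iff_ne.mp hd _ hp.1 _ hp.2, rfl⟩

theorem card_big (o : α) (L₁ L₂ : Finset α) (hd : Disjoint L₁ L₂) :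
    L₁.card * L₂.card ≤ (bigSet o L₁ L₂).card := by
  rw [← Finset.card_product]
  refine le_trans (le_of_eq ?_) (Finset.card_le_card Finset.subset_union_right)
  symm
  apply Finset.card_image_of_injOn
  rintro ⟨i, j⟩ hij ⟨i', j'⟩ hij' h
  simp only [Finset.coe_product, Set.mem_prod, Finset.mem_coe] at hij hij'
  have hne := Finset.disjoint_iff_ne.mp hd
  have h' : swap i j = swap i' j' := h
  have h2 := congrArg (fun e : Perm α => e i) h'
  simp only [swap_apply_left] at h2
  by_cases hii : i = i'
  · subst hii
    simp at h2
    rw [h2]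
  · exfalso
    rw [swap_apply_of_ne_of_ne hii (hne _ hij.1 _ hij'.2)] at h2
    exact hne _ hij.1 _ hij.2 h2.symm

theorem big_touch (o : α) (L₁ L₂ B : Finset α) (h1 : Disjoint L₁ B) (h2 : Disjoint L₂ B)
    (ho : o ∉ B) : ∀ s ∈ bigSet o L₁ L₂, ∀ i ∈ B, s i ≠ i → s = swap o i := by
  intro s hs i hi hsi
  rcases Finset.mem_union.mp hs with hs | hs
  · obtain ⟨j, hj, rfl⟩ := mem_starSet.mp hs
    by_cases hij : i = j
    · rw [hij]
    · have hio : i ≠ o := by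
        rintro rfl
        exact ho hi
      exact absurd (swap_apply_of_ne_of_ne hio hij) hsi
  · obtain ⟨p, hp, rfl⟩ := Finset.mem_image.mp hs
    rw [Finset.mem_product] at hp
    exact absurd (swap_apply_of_ne_of_ne
      (Finset.disjoint_iff_ne.mp h1 _ hp.1 _ hi).symm
      (Finset.disjoint_iff_ne.mp h2 _ hp.2 _ hi).symm) hsi

end Lower

theorem logloglog_le (n : ℕ) (hn : 256 ≤ n) :
    Real.log (Real.log (Real.log (n.factorial : ℝ))) ≤ Real.log n := by
  have hn1 : (256 : ℝ) ≤ n := by exact_mod_cast hn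
  have hf : (n : ℝ) ≤ n.factorial := by exact_mod_cast Nat.self_le_factorial n
  have he : Real.exp 1 < 3 := by have := Real.exp_one_lt_d9; linarith
  have e2 : Real.exp 3 ≤ n := by
    have : Real.exp 3 = Real.exp 1 ^ 3 := by rw [← Real.exp_nat_mul]; norm_num
    rw [this]
    have : Real.exp 1 ^ 3 ≤ 3 ^ 3 := pow_le_pow_left₀ (Real.exp_pos _).le he.le 3
    linarith
  have a1 : (3 : ℝ) ≤ Real.log (n.factorial : ℝ) := by
    rw [Real.le_log_iff_exp_le (by linarith)]
    linarith
  have a2 : 1 ≤ Real.log (Real.log (n.factorial : ℝ)) := by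
    rw [Real.le_log_iff_exp_le (by linarith)]
    linarith
  have ln : 1 ≤ Real.log n := by
    rw [Real.le_log_iff_exp_le (by linarith)]
    have := Real.exp_le_exp.mpr (show (1 : ℝ) ≤ 3 by norm_num)
    linarith
  have b1 : Real.log (n.factorial : ℝ) ≤ n * Real.log n := by
    rw [← Real.log_pow]
    apply Real.log_le_log (by linarith)
    exact_mod_cast Nat.factorial_le_pow n
  have b1' : Real.log (n : ℝ) ≤ n := by
    have := Real.log_le_sub_one_of_pos (show (0 : ℝ) < n by linarith)
    linarith
  have b2 : Real.log (n.factorial : ℝ) ≤ (n : ℝ) ^ 2 := by nlinarith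
  have b3 : Real.log (Real.log (n.factorial : ℝ)) ≤ 2 * Real.log n := by
    have := Real.log_le_log (by linarith) b2
    rw [Real.log_pow] at this
    exact_mod_cast this
  have b4 := Real.log_le_sub_one_of_pos (show 0 < Real.log (Real.log (n.factorial : ℝ)) by linarith)
  have b5 := Real.log_le_log (by linarith) b3
  rw [Real.log_mul (by norm_num) (by linarith)] at b5
  have b6 := Real.log_le_sub_one_of_pos (show 0 < Real.log n by linarith)
  have b7 := Real.log_two_lt_d9
  linarith

/-- Theorem A: there are two sequences of symmetric generating sets of transpositions of the
symmetric group whose Cayley graphs are `(3,0)`-quasi-isometric via the identity map, while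
the total variation mixing times differ by a factor of order `log log log (n!)`. -/
theorem mixing_not_quasi_isometry_invariant :
    ∃ c > (0 : ℝ), ∃ N : ℕ, ∀ n : ℕ, N ≤ n →
      ∃ S S' : Finset (Equiv.Perm (Fin n)),
        (∀ s ∈ S, Equiv.Perm.IsSwap s) ∧ (∀ s ∈ S', Equiv.Perm.IsSwap s) ∧
        IsSymmGen S ∧ IsSymmGen S' ∧
        (∀ σ τ : Equiv.Perm (Fin n),
          wordDist S' σ τ ≤ 3 * wordDist S σ τ ∧ wordDist S σ τ ≤ 3 * wordDist S' σ τ) ∧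
        (tvMixUnif (lazyCayleyP S') : ℝ) ≥
          c * (tvMixUnif (lazyCayleyP S) : ℝ) *
            Real.log (Real.log (Real.log (n.factorial : ℝ))) := by
  refine ⟨1 / 2048, by norm_num, 256, fun n hn => ?_⟩
  obtain ⟨k, hk⟩ : ∃ k, k = n / 4 := ⟨_, rfl⟩
  have hk0 : 1 ≤ k := by omega
  have h3k : 3 * k < n := by omega
  let o : Fin n := ⟨0, by omega⟩
  let p1 : Fin n := ⟨k, by omega⟩
  let p2 : Fin n := ⟨2 * k, by omega⟩
  let p3 : Fin n := ⟨3 * k, by omega⟩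
  let L₁ : Finset (Fin n) := Finset.Ico o p1
  let L₂ : Finset (Fin n) := Finset.Ico p1 p2
  let B : Finset (Fin n) := Finset.Ico p2 p3
  have c1 : L₁.card = k := by simp [L₁, o, p1]
  have c2 : L₂.card = k := by simp [L₂, p1, p2]; omega
  have c3 : B.card = k := by simp [B, p2, p3]; omega
  have d12 : Disjoint L₁ L₂ := by
    rw [Finset.disjoint_left]; intro i hi hj
    simp only [L₁, L₂, Finset.mem_Ico, Fin.le_def, Fin.lt_def, o, p1, p2] at hi hj; omega
  have d1B : Disjoint L₁ B := by
    rw [Finset.disjoint_left]; intro i hi hj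
    simp only [L₁, B, Finset.mem_Ico, Fin.le_def, Fin.lt_def, o, p1, p2, p3] at hi hj; omega
  have d2B : Disjoint L₂ B := by
    rw [Finset.disjoint_left]; intro i hi hj
    simp only [L₂, B, Finset.mem_Ico, Fin.le_def, Fin.lt_def, p1, p2, p3] at hi hj; omega
  have ho : o ∉ B := by
    intro hj
    simp only [B, Finset.mem_Ico, Fin.le_def, Fin.lt_def, o, p2, p3] at hj; omega
  have hS := symmGen_of_star o (starSet o) (isSwap_star o) (le_refl _)
  have hS' := symmGen_of_star o (bigSet o L₁ L₂) (isSwap_big o L₁ L₂ d12)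
    Finset.subset_union_left
  refine ⟨starSet o, bigSet o L₁ L₂, isSwap_star o, isSwap_big o L₁ L₂ d12, hS, hS',
    fun σ τ => ⟨?_, ?_⟩, ?_⟩
  · apply wordDist_le _ _ hS
    intro s hs
    have hs' : s ∈ bigSet o L₁ L₂ := Finset.mem_union_left _ hs
    exact ⟨[s], by simp, by simpa using hs', by simp⟩
  · apply wordDist_le _ _ hS'
    intro s hs
    obtain ⟨i, j, hij, rfl⟩ := isSwap_big o L₁ L₂ d12 s hs
    exact star_list o i j hij
  · have hcard := card_big o L₁ L₂ d12
    rw [c1, c2] at hcard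
    have hne : (bigSet o L₁ L₂).Nonempty := by
      rw [← Finset.card_pos]; nlinarith
    have hn1 : (256 : ℝ) ≤ n := by exact_mod_cast hn
    have hkn : (n : ℝ) ≤ 8 * k := by
      have : n ≤ 8 * k := by omega
      exact_mod_cast this
    have hlog : 0 ≤ Real.log n := Real.log_nonneg (by linarith)
    have hlow := lower_mix (bigSet o L₁ L₂) hS' hne o B ho (big_touch o L₁ L₂ B d1B d2B ho)
      (by rw [c3, Fintype.card_fin]; omega) (Real.log n / 2) (by
        rw [c3]
        have hu : Real.exp (Real.log n / 2) ^ 2 = n := by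
          rw [← Real.exp_nat_mul]
          have : ((2 : ℕ) : ℝ) * (Real.log n / 2) = Real.log n := by push_cast; ring
          rw [this, Real.exp_log (by linarith)]
        have hpos := Real.exp_pos (Real.log n / 2)
        set u := Real.exp (Real.log n / 2)
        have hu16 : 16 ≤ u := by
          by_contra h
          push Not at h
          nlinarith
        nlinarith)
    have hup := star_mix_le (α := Fin n) (by rw [Fintype.card_fin]; omega) o
    rw [Fintype.card_fin] at hup
    have hup' : (tvMixUnif (lazyCayleyP (starSet o)) : ℝ) ≤ 16 * (n : ℝ) ^ 2 := by
      exact_mod_cast hup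
    have hlll := logloglog_le n hn
    have hcard' : (k : ℝ) * k ≤ ((bigSet o L₁ L₂).card : ℝ) := by exact_mod_cast hcard
    have hN : (n : ℝ) ^ 2 / 64 ≤ ((bigSet o L₁ L₂).card : ℝ) := by nlinarith
    have h1 : (n : ℝ) ^ 2 / 64 * (Real.log n / 2) ≤ tvMixUnif (lazyCayleyP (bigSet o L₁ L₂)) :=
      (mul_le_mul_of_nonneg_right hN (by linarith)).trans hlow
    have hm0 : (0 : ℝ) ≤ tvMixUnif (lazyCayleyP (starSet o)) := by positivity
    calc 1 / 2048 * (tvMixUnif (lazyCayleyP (starSet o)) : ℝ)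
          * Real.log (Real.log (Real.log (n.factorial : ℝ)))
        ≤ 1 / 2048 * (tvMixUnif (lazyCayleyP (starSet o)) : ℝ) * Real.log n :=
          mul_le_mul_of_nonneg_left hlll (by positivity)
      _ ≤ 1 / 2048 * (16 * (n : ℝ) ^ 2) * Real.log n := by gcongr
      _ = (n : ℝ) ^ 2 / 64 * (Real.log n / 2) := by ring
      _ ≤ _ := h1
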